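/- Let A > 0 and λ ≥ 0 with A + λ > e, and let P_{X*} be a capacity-achieving input distribution of the amplitude-constrained discrete-time Poisson channel. Then every support point x* of P_{X*} other than 0 and A satisfies e^{-√(2(log(A+λ)−1))} ≤ x* + λ ≤ A + λ − 1. -/

import Mathlib

open MeasureTheory Real Set

noncomputable section

/-- Poisson transition pmf with dark current `lam`:
`P_{Y|X}(y|x) = (x+lam)^y e^{-(x+lam)} / y!` (with the convention `0^0 = 1`). -/
def channelPMF (lam x : ℝ) (y : ℕ) : ℝ :=
  (x + lam) ^ y * Real.exp (-(x + lam)) / (Nat.factorial y)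

/-- Output pmf induced by the input distribution `μ`. -/
def outputPMF (lam : ℝ) (μ : Measure ℝ) (y : ℕ) : ℝ :=
  ∫ x, channelPMF lam x y ∂μ

/-- Kullback–Leibler divergence between pmfs on `ℕ` (natural logarithm). -/
def klDiv (p q : ℕ → ℝ) : ℝ :=
  ∑' y, p y * Real.log (p y / q y)

/-- The function `i(x; μ) = D(P_{Y|X}(·|x) ‖ P_Y^μ)`. -/
def iFun (lam : ℝ) (μ : Measure ℝ) (x : ℝ) : ℝ :=
  klDiv (channelPMF lam x) (outputPMF lam μ)

/-- Mutual information for input distribution `μ`. -/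
def mutualInfo (lam : ℝ) (μ : Measure ℝ) : ℝ :=
  ∫ x, iFun lam μ x ∂μ

/-- Admissible input distributions: probability measures supported in `[0, A]`. -/
def IsInput (A : ℝ) (μ : Measure ℝ) : Prop :=
  IsProbabilityMeasure μ ∧ μ (Set.Icc 0 A)ᶜ = 0

/-- The capacity `C(A, lam)` of the amplitude-constrained Poisson channel. -/
def capacity (A lam : ℝ) : ℝ :=
  sSup (mutualInfo lam '' {μ : Measure ℝ | IsInput A μ})

/-- A capacity-achieving input distribution. -/
def IsCapacityAchieving (A lam : ℝ) (μ : Measure ℝ) : Prop :=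
  IsInput A μ ∧ mutualInfo lam μ = capacity A lam

/-- Topological support of a measure on `ℝ`. -/
def msupport (μ : Measure ℝ) : Set ℝ :=
  {x | ∀ U : Set ℝ, IsOpen U → x ∈ U → 0 < μ U}


/-- Exponential generating function of a real sequence. -/
def egf (a : ℕ → ℝ) (s : ℝ) : ℝ :=
  ∑' y, a y * s ^ y / (Nat.factorial y)

/-- At most geometric growth of a real sequence. -/
def GeomGrowth (a : ℕ → ℝ) : Prop :=
  ∃ K R : ℝ, 0 ≤ K ∧ 0 ≤ R ∧ ∀ y, |a y| ≤ K * R ^ y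

lemma GeomGrowth.shift {a : ℕ → ℝ} (ha : GeomGrowth a) : GeomGrowth (fun y => a (y + 1)) := by
  obtain ⟨K, R, hK, hR, h⟩ := ha
  refine ⟨K * R, R, by positivity, hR, fun y => ?_⟩
  calc |a (y + 1)| ≤ K * R ^ (y + 1) := h _
    _ = K * R * R ^ y := by ring

lemma GeomGrowth.summable {a : ℕ → ℝ} (ha : GeomGrowth a) (s : ℝ) :
    Summable (fun y => a y * s ^ y / (Nat.factorial y : ℝ)) := by
  obtain ⟨K, R, hK, hR, h⟩ := ha
  refine Summable.of_norm_bounded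
    (g := fun y => K * ((R * |s|) ^ y / (Nat.factorial y : ℝ)))
    ((Real.summable_pow_div_factorial (R * |s|)).mul_left K) (fun y => ?_)
  rw [Real.norm_eq_abs, abs_div, abs_mul, abs_pow, Nat.abs_cast, ← mul_div_assoc, mul_pow,
    ← mul_assoc]
  gcongr
  exact h y

lemma GeomGrowth.hasSum {a : ℕ → ℝ} (ha : GeomGrowth a) (s : ℝ) :
    HasSum (fun y => a y * s ^ y / (Nat.factorial y : ℝ)) (egf a s) :=
  (ha.summable s).hasSum

lemma geomGrowth_natCast : GeomGrowth (fun y => (y : ℝ)) := by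
  refine ⟨1, 2, by norm_num, by norm_num, fun y => ?_⟩
  rw [Nat.abs_cast, one_mul]
  exact_mod_cast (Nat.lt_two_pow_self (n := y)).le

lemma mul_succ_mul_div_factorial (b u : ℝ) (y : ℕ) :
    b * (((y + 1 : ℕ) : ℝ) * u) / (Nat.factorial (y + 1) : ℝ)
      = b * u / (Nat.factorial y : ℝ) := by
  rw [Nat.factorial_succ]
  push_cast
  have h : (Nat.factorial y : ℝ) ≠ 0 := by positivity
  have h' : (y : ℝ) + 1 ≠ 0 := by positivity
  field_simp

lemma GeomGrowth.hasDerivAt_egf {a : ℕ → ℝ} (ha : GeomGrowth a) (s : ℝ) :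
    HasDerivAt (egf a) (egf (fun y => a (y + 1)) s) s := by
  have hshift := ha.shift
  obtain ⟨K, R, hK, hR, h⟩ := hshift
  set M : ℝ := |s| + 1 with hM
  have hMpos : 0 < M := by positivity
  have key : HasDerivAt (fun z => ∑' y, a y * z ^ y / (Nat.factorial y : ℝ))
      (∑' y : ℕ, a y * (y * s ^ (y - 1)) / (Nat.factorial y : ℝ)) s := by
    refine hasDerivAt_tsum_of_isPreconnected
      (u := fun y : ℕ => |a y| * (y * M ^ (y - 1)) / (Nat.factorial y : ℝ))
      (t := Metric.ball 0 M) ?_ Metric.isOpen_ball (convex_ball _ _).isPreconnected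
      (g := fun (y : ℕ) (z : ℝ) => a y * z ^ y / (Nat.factorial y : ℝ))
      (g' := fun (y : ℕ) (z : ℝ) => a y * (y * z ^ (y - 1)) / (Nat.factorial y : ℝ))
      (y₀ := s) ?_ ?_ ?_ (ha.summable s) ?_
    · rw [← summable_nat_add_iff 1]
      have : GeomGrowth (fun y => |a (y + 1)|) :=
        ⟨K, R, hK, hR, fun y => by rw [abs_abs]; exact h y⟩
      refine (this.summable M).congr (fun y => ?_)
      rw [Nat.add_sub_cancel, mul_succ_mul_div_factorial]
    · intro y z _
      exact ((hasDerivAt_pow y z).const_mul (a y)).div_const _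
    · intro y z hz
      rw [Metric.mem_ball, dist_zero_right, Real.norm_eq_abs] at hz
      rw [Real.norm_eq_abs, abs_div, abs_mul, abs_mul, abs_pow, Nat.abs_cast, Nat.abs_cast]
      gcongr
    · simp [hM]
    · simp [hM]
  have hS : Summable (fun y : ℕ => a y * (y * s ^ (y - 1)) / (Nat.factorial y : ℝ)) := by
    rw [← summable_nat_add_iff 1]
    refine (ha.shift.summable s).congr (fun y => ?_)
    rw [Nat.add_sub_cancel, mul_succ_mul_div_factorial]
  have e : (∑' y : ℕ, a y * (y * s ^ (y - 1)) / (Nat.factorial y : ℝ))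
      = egf (fun y => a (y + 1)) s := by
    rw [hS.tsum_eq_zero_add]
    simp only [Nat.cast_zero, zero_mul, mul_zero, zero_div, zero_add, egf]
    refine tsum_congr (fun y => ?_)
    rw [Nat.add_sub_cancel, mul_succ_mul_div_factorial]
  rw [e] at key
  exact key

lemma GeomGrowth.continuous_egf {a : ℕ → ℝ} (ha : GeomGrowth a) : Continuous (egf a) :=
  continuous_iff_continuousAt.2 fun s => (ha.hasDerivAt_egf s).continuousAt

lemma geomGrowth_one : GeomGrowth (fun _ => (1 : ℝ)) :=
  ⟨1, 1, by norm_num, by norm_num, fun y => by simp⟩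

lemma egf_one (s : ℝ) : egf (fun _ => (1 : ℝ)) s = Real.exp s := by
  rw [egf, Real.exp_eq_exp_ℝ, NormedSpace.exp_eq_tsum_div]
  simp

lemma egf_natCast (s : ℝ) : egf (fun y => (y : ℝ)) s = s * Real.exp s := by
  rw [egf, (geomGrowth_natCast.summable s).tsum_eq_zero_add, ← egf_one, egf, ← tsum_mul_left]
  simp only [Nat.cast_zero, zero_mul, zero_div, zero_add]
  refine tsum_congr (fun y => ?_)
  have h := mul_succ_mul_div_factorial 1 (s ^ (y + 1)) y
  rw [one_mul] at h
  rw [h]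
  ring

lemma geomGrowth_log {a : ℕ → ℝ} {k c b : ℝ} (hk : 0 < k) (hc : 0 < c)     (h₁ : ∀ y, k * c ^ y ≤ a y) (h₂ : ∀ y, a y ≤ b ^ y) :
    GeomGrowth (fun y => Real.log (a y)) := by
  refine ⟨|Real.log k| + |Real.log c| + |Real.log b|, 2, by positivity, by norm_num,
    fun y => ?_⟩
  have hlow : Real.log k + y * Real.log c ≤ Real.log (a y) := by
    rw [← Real.log_pow, ← Real.log_mul hk.ne' (by positivity)]
    exact Real.log_le_log (by positivity) (h₁ y)
  have hup : Real.log (a y) ≤ y * Real.log b := by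
    rw [← Real.log_pow]
    exact Real.log_le_log (lt_of_lt_of_le (by positivity) (h₁ y)) (h₂ y)
  have hy : (y : ℝ) ≤ 2 ^ y := by exact_mod_cast (Nat.lt_two_pow_self (n := y)).le
  have hy1 : (1 : ℝ) ≤ 2 ^ y := one_le_pow₀ (by norm_num)
  have hk' : |Real.log k| ≤ |Real.log k| * 2 ^ y := le_mul_of_one_le_right (abs_nonneg _) hy1
  have e₁ := mul_le_mul_of_nonneg_left hy (abs_nonneg (Real.log c))
  have e₂ := mul_le_mul_of_nonneg_left hy (abs_nonneg (Real.log b))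
  have e₃ := mul_le_mul_of_nonneg_left (neg_abs_le (Real.log c)) (Nat.cast_nonneg (α := ℝ) y)
  have e₄ := mul_le_mul_of_nonneg_left (le_abs_self (Real.log b)) (Nat.cast_nonneg (α := ℝ) y)
  have e₅ := neg_abs_le (Real.log k)
  have n₁ := abs_nonneg (Real.log k)
  have n₂ := mul_nonneg (abs_nonneg (Real.log c)) (Nat.cast_nonneg (α := ℝ) y)
  have n₃ := mul_nonneg (abs_nonneg (Real.log b)) (Nat.cast_nonneg (α := ℝ) y)
  rw [abs_le]
  constructor <;> nlinarith

lemma channelPMF_mul (lam z b : ℝ) (y : ℕ) :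
    channelPMF lam z y * b
      = Real.exp (-(z + lam)) * (b * (z + lam) ^ y / (Nat.factorial y : ℝ)) := by
  rw [channelPMF]
  ring

lemma GeomGrowth.hasSum_channelPMF_mul {a : ℕ → ℝ} (ha : GeomGrowth a) (lam z : ℝ) :
    HasSum (fun y => channelPMF lam z y * a y) (Real.exp (-(z + lam)) * egf a (z + lam)) := by
  simp only [channelPMF_mul]
  exact (ha.hasSum (z + lam)).mul_left _

lemma hasSum_channelPMF (lam z : ℝ) : HasSum (channelPMF lam z) 1 := by
  have h := geomGrowth_one.hasSum_channelPMF_mul lam z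
  rw [egf_one, ← Real.exp_add, neg_add_cancel, Real.exp_zero] at h
  simpa using h

section Input

variable {A lam : ℝ} {ν : Measure ℝ}

lemma channelPMF_nonneg (hlam : 0 ≤ lam) {z : ℝ} (hz : z ∈ Icc 0 A) (y : ℕ) :
    0 ≤ channelPMF lam z y := by
  have : 0 ≤ z + lam := add_nonneg hz.1 hlam
  rw [channelPMF]
  positivity

lemma channelPMF_le (hlam : 0 ≤ lam) {z : ℝ} (hz : z ∈ Icc 0 A) (y : ℕ) :
    channelPMF lam z y ≤ (A + lam) ^ y / (Nat.factorial y : ℝ) := by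
  have h0 : 0 ≤ z + lam := add_nonneg hz.1 hlam
  have h1 : z + lam ≤ A + lam := by linarith [hz.2]
  rw [channelPMF]
  refine div_le_div_of_nonneg_right ?_ (Nat.cast_nonneg _)
  calc (z + lam) ^ y * Real.exp (-(z + lam)) ≤ (A + lam) ^ y * 1 := by
        exact mul_le_mul (pow_le_pow_left₀ h0 h1 y)
          (Real.exp_le_one_iff.2 (neg_nonpos.2 h0)) (Real.exp_pos _).le
          (pow_nonneg (h0.trans h1) y)
    _ = _ := mul_one _

lemma continuous_channelPMF (lam : ℝ) (y : ℕ) : Continuous (fun z => channelPMF lam z y) := by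
  unfold channelPMF
  fun_prop

lemma IsInput.ae_mem (hν : IsInput A ν) : ∀ᵐ z ∂ν, z ∈ Icc 0 A := hν.2

lemma IsInput.integrable (hν : IsInput A ν) {f : ℝ → ℝ} (hf : ContinuousOn f (Icc 0 A)) :
    Integrable f ν := by
  have := hν.1
  have h : IntegrableOn f (Icc 0 A) ν := hf.integrableOn_compact isCompact_Icc
  rwa [IntegrableOn, Measure.restrict_eq_self_of_ae_mem hν.ae_mem] at h

lemma IsInput.integrable_channelPMF (hν : IsInput A ν) (y : ℕ) :
    Integrable (fun z => channelPMF lam z y) ν :=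
  hν.integrable (continuous_channelPMF lam y).continuousOn

lemma IsInput.outputPMF_nonneg (hν : IsInput A ν) (hlam : 0 ≤ lam) (y : ℕ) :
    0 ≤ outputPMF lam ν y :=
  integral_nonneg_of_ae (hν.ae_mem.mono fun _ hz => channelPMF_nonneg hlam hz y)

lemma ofReal_tsum_le {f h : ℕ → ℝ} (hfh : ∀ y, f y ≤ h y) (hh : ∀ y, 0 ≤ h y) :
    ENNReal.ofReal (∑' y, f y) ≤ ∑' y, ENNReal.ofReal (h y) := by
  by_cases hf : Summable f
  · by_cases hs : Summable h
    · rw [← ENNReal.ofReal_tsum_of_nonneg hh hs]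
      exact ENNReal.ofReal_le_ofReal (hf.tsum_le_tsum hfh hs)
    · have : ∑' y, ENNReal.ofReal (h y) = ⊤ := by
        by_contra hne
        refine hs ((ENNReal.summable_toReal hne).congr fun y => ?_)
        rw [ENNReal.toReal_ofReal (hh y)]
      rw [this]
      exact le_top
  · rw [tsum_eq_zero_of_not_summable hf]
    simp

lemma IsInput.mutualInfo_le (hν : IsInput A ν) (hA : 0 < A) (hlam : 0 ≤ lam) :
    mutualInfo lam ν ≤ Real.exp (A + lam) := by
  by_cases hi : Integrable (iFun lam ν) ν
  swap
  · rw [mutualInfo, integral_undef hi]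
    positivity
  set w : ℕ → ℝ := fun y => (A + lam) ^ y / (Nat.factorial y : ℝ) with hw
  have hw0 : ∀ y, 0 ≤ w y := fun y => by rw [hw]; positivity
  have hq0 := hν.outputPMF_nonneg hlam
  have hpt : ∀ᵐ z ∂ν, ENNReal.ofReal (iFun lam ν z)
      ≤ ∑' y, ENNReal.ofReal (w y / outputPMF lam ν y * channelPMF lam z y) := by
    filter_upwards [hν.ae_mem] with z hz
    refine ofReal_tsum_le (fun y => ?_) (fun y => ?_)
    · have hp := channelPMF_nonneg hlam hz y
      have hu : 0 ≤ channelPMF lam z y / outputPMF lam ν y := div_nonneg hp (hq0 y)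
      calc _ ≤ channelPMF lam z y * (channelPMF lam z y / outputPMF lam ν y) :=
            mul_le_mul_of_nonneg_left (Real.log_le_self hu) hp
        _ ≤ w y * (channelPMF lam z y / outputPMF lam ν y) :=
            mul_le_mul_of_nonneg_right (channelPMF_le hlam hz y) hu
        _ = _ := by ring
    · exact mul_nonneg (div_nonneg (hw0 y) (hq0 y)) (channelPMF_nonneg hlam hz y)
  have hsum : HasSum w (Real.exp (A + lam)) := by
    rw [hw, Real.exp_eq_exp_ℝ]
    exact NormedSpace.expSeries_div_hasSum_exp (A + lam)
  have hlint : ∫⁻ z, ENNReal.ofReal (iFun lam ν z) ∂ν ≤ ENNReal.ofReal (Real.exp (A + lam)) := by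
    refine (lintegral_mono_ae hpt).trans ?_
    rw [lintegral_tsum fun y =>
      ((continuous_channelPMF lam y).measurable.const_mul _).ennreal_ofReal.aemeasurable,
      ← hsum.tsum_eq, ENNReal.ofReal_tsum_of_nonneg hw0 hsum.summable]
    refine ENNReal.tsum_le_tsum fun y => ?_
    rw [← ofReal_integral_eq_lintegral_ofReal ((hν.integrable_channelPMF y).const_mul _)
      (hν.ae_mem.mono fun z hz =>
        mul_nonneg (div_nonneg (hw0 y) (hq0 y)) (channelPMF_nonneg hlam hz y)),
      integral_const_mul]
    refine ENNReal.ofReal_le_ofReal ?_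
    change w y / outputPMF lam ν y * outputPMF lam ν y ≤ w y
    rcases (hq0 y).eq_or_lt with hq | hq
    · rw [← hq, mul_zero]
      exact hw0 y
    · rw [div_mul_cancel₀ _ hq.ne']
  rw [mutualInfo, integral_eq_lintegral_pos_part_sub_lintegral_neg_part hi]
  have h1 := ENNReal.toReal_mono ENNReal.ofReal_ne_top hlint
  rw [ENNReal.toReal_ofReal (by positivity)] at h1
  have h2 : 0 ≤ (∫⁻ z, ENNReal.ofReal (-iFun lam ν z) ∂ν).toReal := ENNReal.toReal_nonneg
  linarith

lemma IsInput.mutualInfo_le_capacity (hν : IsInput A ν) (hA : 0 < A) (hlam : 0 ≤ lam) :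
    mutualInfo lam ν ≤ capacity A lam := by
  refine le_csSup ⟨Real.exp (A + lam), ?_⟩ ⟨ν, hν, rfl⟩
  rintro _ ⟨ν', hν', rfl⟩
  exact hν'.mutualInfo_le hA hlam

end Input

section Optimality

variable {A lam : ℝ} {μ : Measure ℝ}

/-- The output pmf with the factor `1 / y!` removed. -/
def scaledOutput (lam : ℝ) (μ : Measure ℝ) (y : ℕ) : ℝ :=
  (Nat.factorial y : ℝ) * outputPMF lam μ y

/-- A geometric lower bound on `scaledOutput`. -/
def GeomLowerBound (lam : ℝ) (μ : Measure ℝ) : Prop :=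
  ∃ k c : ℝ, 0 < k ∧ 0 < c ∧ ∀ y, k * c ^ y ≤ scaledOutput lam μ y

lemma scaledOutput_eq_integral (lam : ℝ) (μ : Measure ℝ) (y : ℕ) :
    scaledOutput lam μ y = ∫ z, (z + lam) ^ y * Real.exp (-(z + lam)) ∂μ := by
  rw [scaledOutput, outputPMF, ← integral_const_mul]
  refine integral_congr_ae (Filter.Eventually.of_forall fun z => ?_)
  have h : (Nat.factorial y : ℝ) ≠ 0 := by positivity
  simp only [channelPMF]
  field_simp

lemma IsInput.integrable_pow_mul_exp (hμ : IsInput A μ) (y : ℕ) :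
    Integrable (fun z => (z + lam) ^ y * Real.exp (-(z + lam))) μ :=
  hμ.integrable (by fun_prop)

lemma IsInput.scaledOutput_le (hμ : IsInput A μ) (hlam : 0 ≤ lam) (y : ℕ) :
    scaledOutput lam μ y ≤ (A + lam) ^ y := by
  have := hμ.1
  rw [scaledOutput_eq_integral]
  calc _ ≤ ∫ _, (A + lam) ^ y ∂μ := by
        refine integral_mono_ae (hμ.integrable_pow_mul_exp y) (integrable_const _) ?_
        filter_upwards [hμ.ae_mem] with z hz
        have h0 : 0 ≤ z + lam := add_nonneg hz.1 hlam
        have h1 : z + lam ≤ A + lam := by linarith [hz.2]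
        calc (z + lam) ^ y * Real.exp (-(z + lam)) ≤ (A + lam) ^ y * 1 := by
              exact mul_le_mul (pow_le_pow_left₀ h0 h1 y)
                (Real.exp_le_one_iff.2 (neg_nonpos.2 h0)) (Real.exp_pos _).le
                (pow_nonneg (h0.trans h1) y)
          _ = _ := mul_one _
    _ = _ := by simp

lemma IsInput.scaledOutput_succ_le (hμ : IsInput A μ) (hlam : 0 ≤ lam) (y : ℕ) :
    scaledOutput lam μ (y + 1) ≤ (A + lam) * scaledOutput lam μ y := by
  rw [scaledOutput_eq_integral, scaledOutput_eq_integral, ← integral_const_mul]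
  refine integral_mono_ae (hμ.integrable_pow_mul_exp _)
    ((hμ.integrable_pow_mul_exp y).const_mul _) ?_
  filter_upwards [hμ.ae_mem] with z hz
  have h0 : 0 ≤ z + lam := add_nonneg hz.1 hlam
  have h1 : z + lam ≤ A + lam := by linarith [hz.2]
  calc (z + lam) ^ (y + 1) * Real.exp (-(z + lam))
      = (z + lam) * ((z + lam) ^ y * Real.exp (-(z + lam))) := by ring
    _ ≤ _ := by gcongr

lemma IsInput.geomLowerBound (hμ : IsInput A μ) (hlam : 0 ≤ lam) {x : ℝ}
    (hx : x ∈ msupport μ) (hx0 : 0 < x) : GeomLowerBound lam μ := by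
  have := hμ.1
  have hU : 0 < μ (Ioi (x / 2)) := hx _ isOpen_Ioi (by simpa using hx0)
  have hU' : 0 < μ.real (Ioi (x / 2)) := ENNReal.toReal_pos hU.ne' (measure_ne_top _ _)
  refine ⟨μ.real (Ioi (x / 2)) * Real.exp (-(A + lam)), x / 2, by positivity, by positivity,
    fun y => ?_⟩
  rw [scaledOutput_eq_integral]
  calc _ = ∫ z, (Ioi (x / 2)).indicator (fun _ => (x / 2) ^ y * Real.exp (-(A + lam))) z ∂μ := by
        rw [integral_indicator_const _ measurableSet_Ioi, smul_eq_mul]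
        ring
    _ ≤ _ := by
        refine integral_mono_ae ((integrable_const _).indicator measurableSet_Ioi)
          (hμ.integrable_pow_mul_exp y) ?_
        filter_upwards [hμ.ae_mem] with z hz
        have h0 : 0 ≤ z + lam := add_nonneg hz.1 hlam
        by_cases hzU : z ∈ Ioi (x / 2)
        · rw [indicator_of_mem hzU]
          have h2 : x / 2 ≤ z + lam := by
            have : x / 2 < z := hzU
            linarith
          have h3 : z + lam ≤ A + lam := by linarith [hz.2]
          gcongr
        · rw [indicator_of_notMem hzU]
          positivity

lemma GeomLowerBound.scaledOutput_pos (h : GeomLowerBound lam μ) (y : ℕ) :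
    0 < scaledOutput lam μ y := by
  obtain ⟨k, c, hk, hc, h⟩ := h
  exact lt_of_lt_of_le (by positivity) (h y)

lemma GeomLowerBound.outputPMF_pos (h : GeomLowerBound lam μ) (y : ℕ) :
    0 < outputPMF lam μ y := by
  have := h.scaledOutput_pos y
  rw [scaledOutput] at this
  exact pos_of_mul_pos_right this (by positivity)

lemma GeomLowerBound.geomGrowth_log (h : GeomLowerBound lam μ) (hμ : IsInput A μ)
    (hlam : 0 ≤ lam) : GeomGrowth (fun y => Real.log (scaledOutput lam μ y)) := by
  obtain ⟨k, c, hk, hc, h⟩ := h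
  exact _root_.geomGrowth_log hk hc h (hμ.scaledOutput_le hlam)

lemma GeomLowerBound.geomGrowth_ratio (h : GeomLowerBound lam μ) (hA : 0 < A) (hlam : 0 ≤ lam)
    {x : ℝ} (hx : x ∈ Icc 0 A) :
    GeomGrowth (fun y => channelPMF lam x y / outputPMF lam μ y) := by
  have hpos := h.outputPMF_pos
  obtain ⟨k, c, hk, hc, h⟩ := h
  refine ⟨1 / k, (A + lam) / c, by positivity, by positivity, fun y => ?_⟩
  have hf : (0 : ℝ) < (Nat.factorial y : ℝ) := by positivity
  rw [abs_of_nonneg (div_nonneg (channelPMF_nonneg hlam hx y) (hpos y).le)]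
  calc channelPMF lam x y / outputPMF lam μ y
      ≤ ((A + lam) ^ y / (Nat.factorial y : ℝ)) / (k * c ^ y / (Nat.factorial y : ℝ)) := by
        refine div_le_div₀ (by positivity) (channelPMF_le hlam hx y) (by positivity) ?_
        rw [div_le_iff₀ hf, mul_comm (outputPMF lam μ y)]
        exact h y
    _ = _ := by
        rw [div_pow]
        field_simp

lemma channelPMF_mul_log (h : GeomLowerBound lam μ) (hlam : 0 ≤ lam) {z : ℝ}
    (hz : z ∈ Icc 0 A) (y : ℕ) :
    channelPMF lam z y * Real.log (channelPMF lam z y / outputPMF lam μ y)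
      = channelPMF lam z y * y * Real.log (z + lam) - channelPMF lam z y * (z + lam)
        - channelPMF lam z y * Real.log (scaledOutput lam μ y) := by
  have h0 : 0 ≤ z + lam := add_nonneg hz.1 hlam
  rcases (channelPMF_nonneg hlam hz y).eq_or_lt with hp | hp
  · simp [← hp]
  have hpow : (z + lam) ^ y ≠ 0 := by
    intro h'
    simp [channelPMF, h'] at hp
  have e : channelPMF lam z y / outputPMF lam μ y
      = (z + lam) ^ y * Real.exp (-(z + lam)) / scaledOutput lam μ y := by
    have := (h.outputPMF_pos y).ne'
    have hf : (Nat.factorial y : ℝ) ≠ 0 := by positivity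
    rw [channelPMF, scaledOutput]
    field_simp
  rw [e, Real.log_div (mul_ne_zero hpow (Real.exp_pos _).ne') (h.scaledOutput_pos y).ne',
    Real.log_mul hpow (Real.exp_pos _).ne', Real.log_exp, Real.log_pow]
  ring

lemma GeomLowerBound.hasSum_klDiv (h : GeomLowerBound lam μ) (hμ : IsInput A μ)
    (hlam : 0 ≤ lam) {z : ℝ} (hz : z ∈ Icc 0 A) :
    HasSum (fun y => channelPMF lam z y * Real.log (channelPMF lam z y / outputPMF lam μ y))
      ((z + lam) * Real.log (z + lam) - (z + lam)
        - Real.exp (-(z + lam)) * egf (fun y => Real.log (scaledOutput lam μ y)) (z + lam)) := by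
  simp only [channelPMF_mul_log h hlam hz]
  have h₁ := (geomGrowth_natCast.hasSum_channelPMF_mul lam z).mul_right (Real.log (z + lam))
  have h₂ := (hasSum_channelPMF lam z).mul_right (z + lam)
  have h₃ := (h.geomGrowth_log hμ hlam).hasSum_channelPMF_mul lam z
  have e : Real.exp (-(z + lam)) * egf (fun y => (y : ℝ)) (z + lam) = z + lam := by
    rw [egf_natCast, mul_left_comm, ← Real.exp_add, neg_add_cancel, Real.exp_zero, mul_one]
  rw [e] at h₁
  rw [one_mul] at h₂
  exact (h₁.sub h₂).sub h₃

lemma GeomLowerBound.iFun_eq (h : GeomLowerBound lam μ) (hμ : IsInput A μ)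
    (hlam : 0 ≤ lam) {z : ℝ} (hz : z ∈ Icc 0 A) :
    iFun lam μ z = (z + lam) * Real.log (z + lam) - (z + lam)
      - Real.exp (-(z + lam)) * egf (fun y => Real.log (scaledOutput lam μ y)) (z + lam) :=
  (h.hasSum_klDiv hμ hlam hz).tsum_eq

lemma GeomLowerBound.continuousOn_iFun (h : GeomLowerBound lam μ) (hμ : IsInput A μ)
    (hlam : 0 ≤ lam) : ContinuousOn (iFun lam μ) (Icc 0 A) := by
  have hs : Continuous fun z : ℝ => z + lam := by fun_prop
  have hc : Continuous fun z : ℝ => (z + lam) * Real.log (z + lam) - (z + lam)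
      - Real.exp (-(z + lam)) * egf (fun y => Real.log (scaledOutput lam μ y)) (z + lam) :=
    ((Real.continuous_mul_log.comp hs).sub hs).sub
      ((Real.continuous_exp.comp hs.neg).mul ((h.geomGrowth_log hμ hlam).continuous_egf.comp hs))
  exact hc.continuousOn.congr fun z hz => h.iFun_eq hμ hlam hz

/-- The mixture of `μ` with a point mass at `x`. -/
def mixDirac (μ : Measure ℝ) (t x : ℝ) : Measure ℝ :=
  ENNReal.ofReal (1 - t) • μ + ENNReal.ofReal t • Measure.dirac x

lemma IsInput.mixDirac (hμ : IsInput A μ) {t x : ℝ} (ht0 : 0 ≤ t) (ht1 : t ≤ 1)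
    (hx : x ∈ Icc 0 A) : IsInput A (mixDirac μ t x) := by
  have := hμ.1
  refine ⟨⟨?_⟩, ?_⟩
  · simp only [_root_.mixDirac, Measure.coe_add, Measure.coe_smul, Pi.add_apply, Pi.smul_apply,
      measure_univ, smul_eq_mul, mul_one]
    rw [← ENNReal.ofReal_add (by linarith) ht0, sub_add_cancel, ENNReal.ofReal_one]
  · simp [_root_.mixDirac, hμ.2, hx.1, hx.2]

lemma integral_mixDirac {t x : ℝ} (ht0 : 0 ≤ t) (ht1 : t ≤ 1) {f : ℝ → ℝ}
    (hf : Integrable f μ) :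
    ∫ z, f z ∂(mixDirac μ t x) = (1 - t) * ∫ z, f z ∂μ + t * f x := by
  rw [mixDirac, integral_add_measure (hf.smul_measure ENNReal.ofReal_ne_top)
    ((integrable_dirac (by simp)).smul_measure ENNReal.ofReal_ne_top),
    integral_smul_measure, integral_smul_measure, integral_dirac,
    ENNReal.toReal_ofReal (by linarith), ENNReal.toReal_ofReal ht0, smul_eq_mul, smul_eq_mul]

lemma IsInput.outputPMF_mixDirac (hμ : IsInput A μ) {t x : ℝ} (ht0 : 0 ≤ t) (ht1 : t ≤ 1)
    (y : ℕ) :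
    outputPMF lam (_root_.mixDirac μ t x) y
      = (1 - t) * outputPMF lam μ y + t * channelPMF lam x y :=
  integral_mixDirac ht0 ht1 (hμ.integrable_channelPMF y)

lemma GeomLowerBound.mixDirac (h : GeomLowerBound lam μ) (hμ : IsInput A μ) (hlam : 0 ≤ lam)
    {t x : ℝ} (ht0 : 0 ≤ t) (ht1 : t < 1) (hx : x ∈ Icc 0 A) :
    GeomLowerBound lam (mixDirac μ t x) := by
  obtain ⟨k, c, hk, hc, h⟩ := h
  refine ⟨(1 - t) * k, c, mul_pos (by linarith) hk, hc, fun y => ?_⟩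
  rw [scaledOutput, hμ.outputPMF_mixDirac ht0 ht1.le]
  have h₁ := mul_le_mul_of_nonneg_left (h y) (show 0 ≤ 1 - t by linarith)
  have h₂ : 0 ≤ (Nat.factorial y : ℝ) * (t * channelPMF lam x y) :=
    mul_nonneg (by positivity) (mul_nonneg ht0 (channelPMF_nonneg hlam hx y))
  rw [scaledOutput] at h₁
  linarith

/-- The sum `∑ P(y|z) P(y|x) / P_Y(y)`. -/
def crossRatio (lam : ℝ) (μ : Measure ℝ) (x z : ℝ) : ℝ :=
  ∑' y, channelPMF lam z y * (channelPMF lam x y / outputPMF lam μ y)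

lemma GeomLowerBound.integral_crossRatio (h : GeomLowerBound lam μ) (hμ : IsInput A μ)
    (hlam : 0 ≤ lam) {x : ℝ} (hx : x ∈ Icc 0 A) :
    ∫ z, crossRatio lam μ x z ∂μ = 1 := by
  have hI : ∀ y, ∫ z, channelPMF lam z y * (channelPMF lam x y / outputPMF lam μ y) ∂μ
      = channelPMF lam x y := fun y => by
    rw [integral_mul_const]
    change outputPMF lam μ y * _ = _
    rw [mul_div_cancel₀ _ (h.outputPMF_pos y).ne']
  have hN : ∀ y, ∫ z, ‖channelPMF lam z y * (channelPMF lam x y / outputPMF lam μ y)‖ ∂μ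
      = channelPMF lam x y := fun y => by
    refine (integral_congr_ae (hμ.ae_mem.mono fun z hz => Real.norm_of_nonneg ?_)).trans (hI y)
    exact mul_nonneg (channelPMF_nonneg hlam hz y)
      (div_nonneg (channelPMF_nonneg hlam hx y) (h.outputPMF_pos y).le)
  have key := hasSum_integral_of_summable_integral_norm (μ := μ)
    (F := fun y z => channelPMF lam z y * (channelPMF lam x y / outputPMF lam μ y))
    (fun y => (hμ.integrable_channelPMF y).mul_const _)
    (by simpa only [hN] using (hasSum_channelPMF lam x).summable)
  simp only [hI] at key
  exact key.unique (hasSum_channelPMF lam x)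

lemma GeomLowerBound.continuous_crossRatio (h : GeomLowerBound lam μ) (hA : 0 < A)
    (hlam : 0 ≤ lam) {x : ℝ} (hx : x ∈ Icc 0 A) : Continuous (crossRatio lam μ x) := by
  have hr := h.geomGrowth_ratio hA hlam hx
  have e : crossRatio lam μ x = fun z => Real.exp (-(z + lam))
      * egf (fun y => channelPMF lam x y / outputPMF lam μ y) (z + lam) :=
    funext fun z => (hr.hasSum_channelPMF_mul lam z).tsum_eq
  rw [e]
  exact (by fun_prop : Continuous fun z : ℝ => Real.exp (-(z + lam))).mul
    (hr.continuous_egf.comp (by fun_prop))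

lemma GeomLowerBound.le_iFun_mixDirac (h : GeomLowerBound lam μ) (hμ : IsInput A μ)
    (hA : 0 < A) (hlam : 0 ≤ lam) {t x z : ℝ} (ht0 : 0 ≤ t) (ht1 : t < 1) (hx : x ∈ Icc 0 A)
    (hz : z ∈ Icc 0 A) :
    iFun lam μ z + (t - t * crossRatio lam μ x z) ≤ iFun lam (_root_.mixDirac μ t x) z := by
  have h₁ : HasSum (fun y => channelPMF lam z y
      * Real.log (channelPMF lam z y / outputPMF lam μ y)) (iFun lam μ z) :=
    (h.hasSum_klDiv hμ hlam hz).summable.hasSum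
  have h₂ : HasSum (fun y => channelPMF lam z y
      * Real.log (channelPMF lam z y / outputPMF lam (_root_.mixDirac μ t x) y))
      (iFun lam (_root_.mixDirac μ t x) z) :=
    ((h.mixDirac hμ hlam ht0 ht1 hx).hasSum_klDiv (hμ.mixDirac ht0 ht1.le hx) hlam
      hz).summable.hasSum
  have h₃ : HasSum (fun y => channelPMF lam z y * (channelPMF lam x y / outputPMF lam μ y))
      (crossRatio lam μ x z) :=
    ((h.geomGrowth_ratio hA hlam hx).hasSum_channelPMF_mul lam z).summable.hasSum
  have h₄ := h₁.add (((hasSum_channelPMF lam z).mul_left t).sub (h₃.mul_left t))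
  rw [mul_one] at h₄
  refine hasSum_le (fun y => ?_) h₄ h₂
  have hq := h.outputPMF_pos y
  have hp := channelPMF_nonneg hlam hz y
  have hpx := channelPMF_nonneg hlam hx y
  have hqt : 0 < outputPMF lam (_root_.mixDirac μ t x) y :=
    (h.mixDirac hμ hlam ht0 ht1 hx).outputPMF_pos y
  rcases hp.eq_or_lt with hp0 | hp0
  · simp [← hp0]
  have hl := Real.log_le_sub_one_of_pos (div_pos hqt hq)
  rw [Real.log_div hqt.ne' hq.ne'] at hl
  have e : outputPMF lam (_root_.mixDirac μ t x) y / outputPMF lam μ y - 1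
      = -t + t * (channelPMF lam x y / outputPMF lam μ y) := by
    rw [hμ.outputPMF_mixDirac ht0 ht1.le]
    field_simp
    ring
  rw [e] at hl
  rw [Real.log_div hp0.ne' hq.ne', Real.log_div hp0.ne' hqt.ne']
  have := mul_le_mul_of_nonneg_left hl hp
  linarith

/-- The Kuhn–Tucker inequality for capacity-achieving inputs. -/
lemma IsCapacityAchieving.iFun_le (hμ : IsCapacityAchieving A lam μ)
    (h : GeomLowerBound lam μ) (hA : 0 < A) (hlam : 0 ≤ lam) {x : ℝ} (hx : x ∈ Icc 0 A) :
    iFun lam μ x ≤ capacity A lam := by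
  obtain ⟨hin, hcap⟩ := hμ
  have := hin.1
  have hiμ : Integrable (iFun lam μ) μ := hin.integrable (h.continuousOn_iFun hin hlam)
  have hR : Integrable (crossRatio lam μ x) μ :=
    hin.integrable (h.continuous_crossRatio hA hlam hx).continuousOn
  have step : ∀ t : ℝ, 0 < t → t < 1 →
      iFun lam μ x ≤ capacity A lam + t * (crossRatio lam μ x x - 1) := by
    intro t ht0 ht1
    have hinν := hin.mixDirac ht0.le ht1.le hx
    have hiν : Integrable (iFun lam (mixDirac μ t x)) μ :=
      hin.integrable ((h.mixDirac hin hlam ht0.le ht1 hx).continuousOn_iFun hinν hlam)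
    have hle := hinν.mutualInfo_le_capacity hA hlam
    rw [mutualInfo, integral_mixDirac ht0.le ht1.le hiν] at hle
    have h₁ : capacity A lam ≤ ∫ z, iFun lam (mixDirac μ t x) z ∂μ := by
      have hc : Integrable (fun z => t - t * crossRatio lam μ x z) μ :=
        (integrable_const t).sub (hR.const_mul t)
      calc capacity A lam = ∫ z, iFun lam μ z + (t - t * crossRatio lam μ x z) ∂μ := by
            rw [integral_add hiμ hc, integral_sub (integrable_const t) (hR.const_mul t),
              integral_const_mul, h.integral_crossRatio hin hlam hx, ← hcap, mutualInfo]
            simp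
        _ ≤ _ := integral_mono_ae (hiμ.add hc) hiν
            (hin.ae_mem.mono fun z hz => h.le_iFun_mixDirac hin hA hlam ht0.le ht1 hx hz)
    have h₂ := h.le_iFun_mixDirac hin hA hlam ht0.le ht1 hx hx
    have h₃ := mul_le_mul_of_nonneg_left h₁ (show 0 ≤ 1 - t by linarith)
    have h₄ := mul_le_mul_of_nonneg_left h₂ ht0.le
    nlinarith
  by_contra! hlt
  set δ := iFun lam μ x - capacity A lam with hδ
  have hδ0 : 0 < δ := sub_pos.2 hlt
  set K := |crossRatio lam μ x x - 1| with hK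
  have hK0 : 0 ≤ K := abs_nonneg _
  have ht0 : 0 < δ / (δ + K + 1) := by positivity
  have ht1 : δ / (δ + K + 1) < 1 := by
    rw [div_lt_one (by positivity)]
    linarith
  have hs := step _ ht0 ht1
  have hb := mul_le_mul_of_nonneg_left (le_abs_self (crossRatio lam μ x x - 1)) ht0.le
  rw [← hK] at hb
  have : δ / (δ + K + 1) * K < δ := by
    rw [div_mul_eq_mul_div, div_lt_iff₀ (by positivity)]
    nlinarith
  linarith

/-- Equality holds in the Kuhn–Tucker condition at interior support points. -/
lemma IsCapacityAchieving.iFun_eq (hμ : IsCapacityAchieving A lam μ)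
    (h : GeomLowerBound lam μ) (hA : 0 < A) (hlam : 0 ≤ lam) {x : ℝ} (hx : x ∈ Ioo 0 A)
    (hxs : x ∈ msupport μ) : iFun lam μ x = capacity A lam := by
  have hle := fun z hz => hμ.iFun_le h hA hlam (x := z) hz
  obtain ⟨hin, hcap⟩ := hμ
  have := hin.1
  have hcont := h.continuousOn_iFun hin hlam
  have hiμ : Integrable (iFun lam μ) μ := hin.integrable hcont
  refine le_antisymm (hle x (Ioo_subset_Icc_self hx)) ?_
  by_contra! hlt
  have h0 : ∫ z, (capacity A lam - iFun lam μ z) ∂μ = 0 := by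
    rw [integral_sub (integrable_const _) hiμ, ← hcap, mutualInfo]
    simp
  rw [integral_eq_zero_iff_of_nonneg_ae (hin.ae_mem.mono fun z hz => sub_nonneg.2 (hle z hz))
    ((integrable_const _).sub hiμ)] at h0
  have hopen : IsOpen (Ioo 0 A ∩ iFun lam μ ⁻¹' Iio (capacity A lam)) :=
    (hcont.mono Ioo_subset_Icc_self).isOpen_inter_preimage isOpen_Ioo isOpen_Iio
  refine (hxs _ hopen ⟨hx, hlt⟩).ne' (measure_mono_null ?_ h0)
  rintro z ⟨-, hz⟩ hz'
  have hz1 : iFun lam μ z < capacity A lam := hz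
  have hz2 : capacity A lam - iFun lam μ z = 0 := hz'
  linarith

end Optimality

lemma IsInput.mem_Icc_of_mem_msupport {A : ℝ} {μ : Measure ℝ} (hμ : IsInput A μ) {x : ℝ}
    (hx : x ∈ msupport μ) : x ∈ Icc 0 A := by
  by_contra h
  exact (hx _ isClosed_Icc.isOpen_compl h).ne' hμ.2

/-- First and second order conditions at an interior support point. -/
lemma IsCapacityAchieving.log_add_inv_le {A lam : ℝ} {μ : Measure ℝ}
    (hμ : IsCapacityAchieving A lam μ) (hA : 0 < A) (hlam : 0 ≤ lam) {x : ℝ}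
    (hx : x ∈ Ioo 0 A) (hxs : x ∈ msupport μ) :
    Real.log (x + lam) + (x + lam)⁻¹ ≤ Real.log (A + lam) := by
  have hin := hμ.1
  have h := hin.geomLowerBound hlam hxs hx.1
  set g : ℕ → ℝ := fun y => Real.log (scaledOutput lam μ y) with hg
  have hgg : GeomGrowth g := h.geomGrowth_log hin hlam
  set C := capacity A lam with hC
  set H : ℝ → ℝ := fun s => Real.exp s * (s * Real.log s - s - C) - egf g s with hH
  have hHi : ∀ z ∈ Icc 0 A, H (z + lam) = Real.exp (z + lam) * (iFun lam μ z - C) := by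
    intro z hz
    rw [h.iFun_eq hin hlam hz]
    have e : Real.exp (z + lam) * Real.exp (-(z + lam)) = 1 := by
      rw [← Real.exp_add, add_neg_cancel, Real.exp_zero]
    simp only [hH, ← hg]
    linear_combination egf g (z + lam) * e
  set s₀ := x + lam with hs₀
  have hs₀pos : 0 < s₀ := by linarith [hx.1]
  have hHx : H s₀ = 0 := by
    rw [hs₀, hHi x (Ioo_subset_Icc_self hx), hμ.iFun_eq h hA hlam hx hxs, sub_self, mul_zero]
  have hmax : IsLocalMax H s₀ := by
    have hnb : Ioo lam (A + lam) ∈ nhds s₀ :=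
      Ioo_mem_nhds (by linarith [hx.1]) (by linarith [hx.2])
    filter_upwards [hnb] with s hs
    have hz : s - lam ∈ Icc 0 A := ⟨by linarith [hs.1], by linarith [hs.2]⟩
    have e := hHi _ hz
    rw [sub_add_cancel] at e
    rw [hHx, e]
    exact mul_nonpos_of_nonneg_of_nonpos (Real.exp_pos _).le
      (sub_nonpos.2 (hμ.iFun_le h hA hlam hz))
  set H₁ : ℝ → ℝ := fun s => Real.exp s * (s * Real.log s - s - C + Real.log s)
    - egf (fun y => g (y + 1)) s with hH₁
  have hd : ∀ s : ℝ, 0 < s → HasDerivAt H (H₁ s) s := by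
    intro s hs
    have d := ((Real.hasDerivAt_exp s).mul
      (((Real.hasDerivAt_mul_log hs.ne').sub (hasDerivAt_id s)).sub_const C)).sub
      (hgg.hasDerivAt_egf s)
    refine d.congr_deriv ?_
    simp only [hH₁, id, Pi.sub_apply]
    ring
  have hd₁ : HasDerivAt H₁ (Real.exp s₀ * (s₀ * Real.log s₀ - s₀ - C + 2 * Real.log s₀ + s₀⁻¹)
      - egf (fun y => g (y + 1 + 1)) s₀) s₀ := by
    have d := ((Real.hasDerivAt_exp s₀).mul
      ((((Real.hasDerivAt_mul_log hs₀pos.ne').sub (hasDerivAt_id s₀)).sub_const C).add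
        (Real.hasDerivAt_log hs₀pos.ne'))).sub (hgg.shift.hasDerivAt_egf s₀)
    refine d.congr_deriv ?_
    simp only [id, Pi.sub_apply, Pi.add_apply]
    ring
  have hderiv : deriv H =ᶠ[nhds s₀] H₁ :=
    (eventually_gt_nhds hs₀pos).mono fun s hs => (hd s hs).deriv
  have hfirst : H₁ s₀ = 0 := hmax.hasDerivAt_eq_zero (hd s₀ hs₀pos)
  have hsecond : deriv (deriv H) s₀ ≤ 0 := by
    by_contra! hpos
    have hmin : IsLocalMin H s₀ := isLocalMin_of_deriv_deriv_pos hpos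
      (by rw [hderiv.eq_of_nhds, hfirst]) (hd s₀ hs₀pos).continuousAt
    have hconst : H =ᶠ[nhds s₀] fun _ => H s₀ := by
      filter_upwards [hmax, hmin] with s h₁ h₂ using le_antisymm h₁ h₂
    have : deriv (deriv H) s₀ = 0 := by
      rw [hconst.deriv.deriv_eq]
      simp
    linarith
  rw [hderiv.deriv_eq, hd₁.deriv] at hsecond
  have hinc : egf (fun y => g (y + 1 + 1)) s₀
      ≤ egf (fun y => g (y + 1)) s₀ + Real.log (A + lam) * Real.exp s₀ := by
    have hexp := (geomGrowth_one.hasSum s₀).mul_left (Real.log (A + lam))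
    rw [egf_one] at hexp
    refine hasSum_le (fun y => ?_) (hgg.shift.shift.hasSum s₀)
      ((hgg.shift.hasSum s₀).add hexp)
    have hstep : g (y + 1 + 1) ≤ Real.log (A + lam) + g (y + 1) := by
      have hp := h.scaledOutput_pos (y + 1)
      simp only [hg]
      rw [← Real.log_mul (by positivity) hp.ne']
      exact Real.log_le_log (h.scaledOutput_pos _) (hin.scaledOutput_succ_le hlam _)
    have hw : 0 ≤ s₀ ^ y / (Nat.factorial y : ℝ) := by positivity
    have := mul_le_mul_of_nonneg_right hstep hw
    calc _ = g (y + 1 + 1) * (s₀ ^ y / (Nat.factorial y : ℝ)) := by ring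
      _ ≤ _ := this
      _ = _ := by ring
  have hfin : Real.exp s₀ * (Real.log s₀ + s₀⁻¹) ≤ Real.exp s₀ * Real.log (A + lam) := by
    simp only [hH₁] at hfirst
    linarith
  exact le_of_mul_le_mul_left hfin (Real.exp_pos _)

lemma bounds_of_log_add_inv_le {s B : ℝ} (hs : 0 < s) (hB : 0 < B)
    (h : Real.log s + s⁻¹ ≤ Real.log B) :
    Real.exp (-Real.sqrt (2 * (Real.log B - 1))) ≤ s ∧ s ≤ B - 1 := by
  constructor
  · rw [← Real.le_log_iff_exp_le hs, neg_le]
    rcases le_or_gt 0 (-Real.log s) with ht | ht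
    · refine Real.le_sqrt_of_sq_le ?_
      have hq := Real.quadratic_le_exp_of_nonneg ht
      rw [Real.exp_neg, Real.exp_log hs] at hq
      linarith
    · exact ht.le.trans (Real.sqrt_nonneg _)
  · have hl := Real.log_le_sub_one_of_pos (div_pos hB hs)
    rw [Real.log_div hB.ne' hs.ne'] at hl
    have h' : s⁻¹ ≤ B / s - 1 := by linarith
    have := mul_le_mul_of_nonneg_left h' hs.le
    rw [mul_inv_cancel₀ hs.ne', mul_sub, mul_div_cancel₀ _ hs.ne'] at this
    linarith

/-- On the location of interior support points. -/
theorem interior_support_point_bounds (A lam : ℝ) (hA : 0 < A) (hlam : 0 ≤ lam)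
    (hAe : Real.exp 1 < A + lam)
    (μ : Measure ℝ) (hμ : IsCapacityAchieving A lam μ)
    (x : ℝ) (hx : x ∈ msupport μ) (hx0 : x ≠ 0) (hxA : x ≠ A) :
    Real.exp (-Real.sqrt (2 * (Real.log (A + lam) - 1))) ≤ x + lam ∧
      x + lam ≤ A + lam - 1 := by
  have hmem := hμ.1.mem_Icc_of_mem_msupport hx
  have hpos : 0 < x := lt_of_le_of_ne hmem.1 hx0.symm
  exact bounds_of_log_add_inv_le (by linarith) (by linarith)
    (hμ.log_add_inv_le hA hlam ⟨hpos, lt_of_le_of_ne hmem.2 hxA⟩ hx)
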